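/- arXiv:1807.10468 — 2 statements merged into one kernel-verified Lean document; each statement's English description precedes it below -/
import Mathlib

section
/- For the game CSG({1,...,N}) with N ≥ 3, if k > N and ℓ ≡ N mod (N+1), then the Grundy value of S(1,k,ℓ) equals the Grundy value of S(1, (k mod (N+1)) + N + 1, N). -/
open SimpleGraph

/-- The minimum excludant of a set of naturals. -/
noncomputable def mex (s : Set ℕ) : ℕ := sInf {n | n ∉ s}

/-- The graph induced on a set of vertices is connected. -/
def ConnOn {V : Type*} (G : SimpleGraph V) (s : Set V) : Prop := (G.induce s).Connected

/-- A legal move in the connected subtraction game CSG(L) on the graph `G`: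
from remaining vertex set `s`, remove the (nonempty) connected set `s \ t` whose
cardinality lies in `L`, leaving `t`, which must be empty or induce a connected graph. -/
def CsgMove {V : Type*} [DecidableEq V] (G : SimpleGraph V) (L : Set ℕ)
    (s t : Finset V) : Prop :=
  t ⊆ s ∧ (s \ t).Nonempty ∧ (s \ t).card ∈ L ∧
    ConnOn G (↑(s \ t) : Set V) ∧ (t = ∅ ∨ ConnOn G (↑t : Set V))

/-- The Grundy value of the position with remaining vertex set `s` in the game
CSG(L) played on `G`, defined by the mex recursion over all legal moves. -/
noncomputable def csgGrundy {V : Type*} [DecidableEq V] (G : SimpleGraph V) (L : Set ℕ)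
    (s : Finset V) : ℕ :=
  mex (Set.range fun t : {t : Finset V // CsgMove G L s t} =>
    have : t.1.card < s.card := by
      obtain ⟨x, hx⟩ := t.2.2.1
      rw [Finset.mem_sdiff] at hx
      exact Finset.card_lt_card ((Finset.ssubset_iff_of_subset t.2.1).2 ⟨x, hx.1, hx.2⟩)
    csgGrundy G L t.1)
termination_by s.card
decreasing_by exact this

/-- The subdivided star with `t` branches of lengths `l 0, …, l (t-1)` appended
to a central vertex `none`. -/
def subdividedStar {t : ℕ} (l : Fin t → ℕ) :
    SimpleGraph (Option (Σ i : Fin t, Fin (l i))) :=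
  SimpleGraph.fromRel fun a b =>
    match a, b with
    | none, some ⟨_, j⟩ => (j : ℕ) = 0
    | some ⟨i, j⟩, some ⟨i', j'⟩ => (i : ℕ) = (i' : ℕ) ∧ (j : ℕ) + 1 = (j' : ℕ)
    | _, _ => False

/-- The graph `G` with a path on `k` new vertices appended at the vertex `u`. -/
def appendPath {V : Type*} (G : SimpleGraph V) (u : V) (k : ℕ) :
    SimpleGraph (V ⊕ Fin k) :=
  SimpleGraph.fromRel fun a b =>
    match a, b with
    | Sum.inl x, Sum.inl y => G.Adj x y
    | Sum.inl x, Sum.inr j => x = u ∧ (j : ℕ) = 0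
    | Sum.inr j, Sum.inr j' => (j : ℕ) + 1 = (j' : ℕ)
    | _, _ => False

/-- `x` is the least natural number not satisfying `P`. -/
def IsMex (x : ℕ) (P : ℕ → Prop) : Prop := ¬ P x ∧ ∀ v < x, P v

theorem IsMex.unique {x y : ℕ} {P : ℕ → Prop} (hx : IsMex x P) (hy : IsMex y P) : x = y := by
  rcases lt_trichotomy x y with h | h | h
  · exact absurd (hy.2 x h) hx.1
  · exact h
  · exact absurd (hx.2 y h) hy.1

theorem isMex_mex {s : Set ℕ} (hs : s.Finite) : IsMex (mex s) (· ∈ s) := by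
  have hne : {n | n ∉ s}.Nonempty := hs.infinite_compl.nonempty
  refine ⟨Nat.sInf_mem hne, fun v hv => ?_⟩
  by_contra h
  exact Nat.notMem_of_lt_sInf hv h

/-- The Grundy values of the paths that can be reached in one move from `S(1, k, l)`, where
`k = a + (N + 1) q` and `l = b + (N + 1) p` with `a, b ≤ N`. -/
def PathOpt (N a q b p v : ℕ) : Prop :=
  v ≤ N ∧ (v = a + b + 1 ∨ v + N = a + b ∨
    (q = 0 ∧ p = 0 ∧ (v ≤ a ∨ v ≤ b) ∧ a + b + 2 ≤ v + N) ∨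
    (q = 0 ∧ 0 < p ∧ ((v ≤ b ∧ a + b + 2 ≤ v + N) ∨ (b < v ∧ a + b + 3 ≤ v))) ∨
    (0 < q ∧ p = 0 ∧ ((v ≤ a ∧ a + b + 2 ≤ v + N) ∨ (a < v ∧ a + b + 3 ≤ v))))

/-- The Grundy values of the options of `S(1, k, l)`, where `k = a + (N + 1) q`,
`l = b + (N + 1) p` with `a, b ≤ N`, and `B a q b p` is the Grundy value of `S(1, k, l)`. -/
def BlockOpt (N : ℕ) (B : ℕ → ℕ → ℕ → ℕ → ℕ) (a q b p v : ℕ) : Prop :=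
  (∃ a' < a, v = B a' q b p) ∨ (∃ a', a < a' ∧ a' ≤ N ∧ ∃ q', q = q' + 1 ∧ v = B a' q' b p) ∨
  (∃ b' < b, v = B a q b' p) ∨ (∃ b', b < b' ∧ b' ≤ N ∧ ∃ p', p = p' + 1 ∧ v = B a q b' p') ∨
  PathOpt N a q b p v

/-- `B` satisfies the Grundy recursion of the stars `S(1, k, l)` and is symmetric. -/
structure BlockRec (N : ℕ) (B : ℕ → ℕ → ℕ → ℕ → ℕ) : Prop where
  pos : 0 < N
  symm : ∀ a q b p, B a q b p = B b p a q
  isMex : ∀ a q b p, a ≤ N → b ≤ N → IsMex (B a q b p) (BlockOpt N B a q b p)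

/-- The sequence whose `a`-th term is the least number that is neither an earlier term
nor an element of `E a`. -/
noncomputable def greedy (E : ℕ → Finset ℕ) (a : ℕ) : ℕ :=
  mex (Set.range (fun i : Fin a => greedy E i) ∪ ↑(E a))
decreasing_by exact i.2

theorem isMex_greedy (E : ℕ → Finset ℕ) (a : ℕ) :
    IsMex (greedy E a) (fun v => (∃ i < a, v = greedy E i) ∨ v ∈ E a) := by
  have h := isMex_mex ((Set.finite_range (fun i : Fin a => greedy E i)).union
    (E a).finite_toSet)
  rw [← greedy] at h
  have e : (fun v => v ∈ Set.range (fun i : Fin a => greedy E i) ∪ ↑(E a)) =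
      fun v => (∃ i < a, v = greedy E i) ∨ v ∈ E a := by
    funext v
    simp only [Set.mem_union, Set.mem_range, Finset.mem_coe, eq_iff_iff]
    constructor
    · rintro (⟨i, rfl⟩ | h)
      · exact Or.inl ⟨i, i.2, rfl⟩
      · exact Or.inr h
    · rintro (⟨i, hi, rfl⟩ | h)
      · exact Or.inl ⟨⟨i, hi⟩, rfl⟩
      · exact Or.inr h
  rwa [e] at h

namespace BlockRec

/-- The Grundy values of `S(1, N + 1 + a, N)` for `a < N`. -/
noncomputable def tail (N : ℕ) (B : ℕ → ℕ → ℕ → ℕ → ℕ) : ℕ → ℕ :=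
  greedy fun a => (Finset.Ioo a N).image (fun i => B i 0 N 0) ∪
    (Finset.range N).image (fun b => B a 0 b 0)

variable {N : ℕ} {B : ℕ → ℕ → ℕ → ℕ → ℕ}

theorem base_values (hB : BlockRec N B) (n : ℕ) : ∀ a b, a + b = n → a < N → b < N →
    (N ≤ a + b + 1 → B a 0 b 0 + N = a + b + 1) ∧
    (a + b + 2 ≤ N → a < B a 0 b 0 ∧ b < B a 0 b 0 ∧ B a 0 b 0 ≤ a + b + 2 ∧
      B a 0 b 0 ≠ a + b + 1) := by
  induction n using Nat.strong_induction_on with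
  | _ n ih =>
  intro a b hn ha hb
  have hcol : ∀ a' < a, _ := fun a' h => ih (a' + b) (by omega) a' b rfl (by omega) hb
  have hrow : ∀ b' < b, _ := fun b' h => ih (a + b') (by omega) a b' rfl ha (by omega)
  obtain ⟨h1, h2⟩ := hB.isMex a 0 b 0 ha.le hb.le
  have hpath : ∀ v, PathOpt N a 0 b 0 v → v ≠ B a 0 b 0 := by
    rintro v hv rfl
    exact h1 (Or.inr (Or.inr (Or.inr (Or.inr hv))))
  constructor
  · intro hab
    have key : IsMex (a + b + 1 - N) (BlockOpt N B a 0 b 0) := by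
      constructor
      · rintro (⟨a', h, e⟩ | ⟨a', h, h', q', hq, -⟩ | ⟨b', h, e⟩ | ⟨b', h, h', q', hq, -⟩ | h)
        · have := hcol a' h
          omega
        · omega
        · have := hrow b' h
          omega
        · omega
        · unfold PathOpt at h
          omega
      · intro v hv
        refine Or.inl ⟨v + N - 1 - b, by omega, ?_⟩
        have := hcol (v + N - 1 - b) (by omega)
        omega
    have := key.unique (hB.isMex a 0 b 0 ha.le hb.le)
    omega
  · intro hab
    refine ⟨?_, ?_, ?_, ?_⟩
    · by_contra h
      exact hpath _ (by unfold PathOpt; omega) rfl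
    · by_contra h
      exact hpath _ (by unfold PathOpt; omega) rfl
    · by_contra h
      rcases h2 (a + b + 2) (by omega) with
        ⟨a', h, e⟩ | ⟨a', h, h', q', hq, -⟩ | ⟨b', h, e⟩ | ⟨b', h, h', q', hq, -⟩ | h
      · have := hcol a' h
        omega
      · omega
      · have := hrow b' h
        omega
      · omega
      · unfold PathOpt at h
        omega
    · intro h
      exact hpath _ (by unfold PathOpt; omega) rfl

theorem base_eq (hB : BlockRec N B) {a b : ℕ} (ha : a < N) (hb : b < N)
    (h : N ≤ a + b + 1) : B a 0 b 0 + N = a + b + 1 :=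
  (hB.base_values _ a b rfl ha hb).1 h

theorem base_bounds (hB : BlockRec N B) {a b : ℕ} (h : a + b + 2 ≤ N) :
    a < B a 0 b 0 ∧ b < B a 0 b 0 ∧ B a 0 b 0 ≤ a + b + 2 ∧ B a 0 b 0 ≠ a + b + 1 :=
  (hB.base_values _ a b rfl (by omega) (by omega)).2 h

theorem base_le (hB : BlockRec N B) {a b : ℕ} (ha : a < N) (hb : b < N) : B a 0 b 0 ≤ N := by
  rcases le_or_gt N (a + b + 1) with h | h
  · have := hB.base_eq ha hb h
    omega
  · have := hB.base_bounds (a := a) (b := b) (by omega)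
    omega

theorem row_ne (hB : BlockRec N B) (q p : ℕ) {a b b' : ℕ} (ha : a ≤ N) (hb : b ≤ N)
    (hb' : b' ≤ N) (h : b ≠ b') : B a q b p ≠ B a q b' p := by
  intro e
  rcases Nat.lt_or_gt_of_ne h with h | h
  · exact (hB.isMex a q b' p ha hb').1 (Or.inr (Or.inr (Or.inl ⟨b, h, e.symm⟩)))
  · exact (hB.isMex a q b p ha hb).1 (Or.inr (Or.inr (Or.inl ⟨b', h, e⟩)))

theorem col_ne (hB : BlockRec N B) (q p : ℕ) {a a' b : ℕ} (ha : a ≤ N) (ha' : a' ≤ N)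
    (hb : b ≤ N) (h : a ≠ a') : B a q b p ≠ B a' q b p := by
  rw [hB.symm a, hB.symm a']
  exact hB.row_ne p q hb ha ha' h

theorem exists_base_eq (hB : BlockRec N B) {a v : ℕ} (ha : a < N) (hv : v ≤ a) :
    ∃ b < N, a + b + 1 = v + N ∧ B a 0 b 0 = v := by
  refine ⟨v + N - 1 - a, by omega, by omega, ?_⟩
  have := hB.base_eq (b := v + N - 1 - a) ha (by omega) (by omega)
  omega

theorem edge_isMex (hB : BlockRec N B) {a : ℕ} (ha : a < N) (p : ℕ) :
    IsMex (B a 0 N p) (fun v => (∃ a' < a, v = B a' 0 N p) ∨ (∃ b < N, v = B a 0 b p) ∨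
      (v ≤ N ∧ (v = a ∨ a + 2 ≤ v))) := by
  have h := hB.isMex a 0 N p ha.le le_rfl
  convert h using 1
  funext v
  simp only [BlockOpt, eq_iff_iff]
  constructor
  · rintro (h | h | h)
    · exact Or.inl h
    · exact Or.inr (Or.inr (Or.inl h))
    · refine Or.inr (Or.inr (Or.inr (Or.inr ?_)))
      unfold PathOpt
      omega
  · rintro (h | ⟨_, _, _, _, h, -⟩ | h | ⟨_, _, _, _⟩ | h)
    · exact Or.inl h
    · omega
    · exact Or.inr (Or.inl h)
    · omega
    · refine Or.inr (Or.inr ?_)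
      unfold PathOpt at h
      omega

theorem edge_ne_base (hB : BlockRec N B) {a b : ℕ} (ha : a < N) (hb : b < N) :
    B a 0 N 0 ≠ B a 0 b 0 :=
  hB.row_ne 0 0 ha.le le_rfl hb.le (by omega)

theorem edge_eq (hB : BlockRec N B) {a : ℕ} (ha : a < N) (h : B a 0 N 0 ≤ N) :
    B a 0 N 0 = a + 1 := by
  have h1 := (hB.edge_isMex ha 0).1
  by_contra h2
  rcases le_or_gt (B a 0 N 0) a with h3 | h3
  · obtain ⟨b, hb, -, e⟩ := hB.exists_base_eq ha h3
    exact h1 (Or.inr (Or.inl ⟨b, hb, e.symm⟩))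
  · exact h1 (Or.inr (Or.inr ⟨h, by omega⟩))

theorem tail_isMex (N : ℕ) (B : ℕ → ℕ → ℕ → ℕ → ℕ) (a : ℕ) :
    IsMex (tail N B a) (fun v => (∃ i < a, v = tail N B i) ∨
      (∃ i, a < i ∧ i < N ∧ v = B i 0 N 0) ∨ ∃ b < N, v = B a 0 b 0) := by
  have h : IsMex (tail N B a) _ := isMex_greedy (fun a => (Finset.Ioo a N).image
    (fun i => B i 0 N 0) ∪ (Finset.range N).image (fun b => B a 0 b 0)) a
  convert h using 1
  funext v
  simp only [tail, Finset.mem_union, Finset.mem_image, Finset.mem_Ioo, Finset.mem_range,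
    eq_comm (a := v), and_assoc]

theorem tail_ne_base {a b : ℕ} (hb : b < N) : tail N B a ≠ B a 0 b 0 :=
  fun h => (tail_isMex N B a).1 (Or.inr (Or.inr ⟨b, hb, h⟩))

theorem tail_injective : Function.Injective (tail N B) := by
  intro a b h
  by_contra hab
  rcases Nat.lt_or_gt_of_ne hab with hab | hab
  · exact (tail_isMex N B b).1 (Or.inl ⟨a, hab, h.symm⟩)
  · exact (tail_isMex N B a).1 (Or.inl ⟨b, hab, h⟩)

theorem tail_ne_edge {a i : ℕ} (h : a < i) (hi : i < N) : tail N B a ≠ B i 0 N 0 :=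
  fun e => (tail_isMex N B a).1 (Or.inr (Or.inl ⟨i, h, hi, e⟩))

theorem lt_tail (hB : BlockRec N B) {a : ℕ} (ha : a < N) : a < tail N B a := by
  by_contra h
  obtain ⟨b, hb, -, e⟩ := hB.exists_base_eq ha (not_lt.1 h)
  exact tail_ne_base hb e.symm

theorem tail_eq_edge (hB : BlockRec N B) {a : ℕ} (ha : a < N) (h : B a 0 N 0 ≤ N) :
    tail N B a = B a 0 N 0 := by
  refine (tail_isMex N B a).unique ⟨?_, fun v hv => ?_⟩
  · rintro (⟨i, hi, e⟩ | ⟨i, hi, hi', e⟩ | ⟨b, hb, e⟩)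
    · exact tail_ne_edge hi ha e.symm
    · exact hB.col_ne 0 0 ha.le hi'.le le_rfl hi.ne e
    · exact hB.edge_ne_base ha hb e
  · obtain ⟨b, hb, -, e⟩ := hB.exists_base_eq (v := v) ha (by have := hB.edge_eq ha h; omega)
    exact Or.inr (Or.inr ⟨b, hb, e.symm⟩)

/-- Among the first `a` terms, the values above `N` form intervals starting at `N + 1`, for both
sequences, and there are at least as many of them on the edge as on the tail. -/
theorem large_values (hB : BlockRec N B) (a : ℕ) (ha : a ≤ N) : ∃ s d, s ≤ d ∧
    (∀ v, N < v → ((∃ i < a, tail N B i = v) ↔ v ≤ N + s)) ∧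
    (∀ v, N < v → ((∃ i < a, B i 0 N 0 = v) ↔ v ≤ N + d)) := by
  induction a with
  | zero => exact ⟨0, 0, le_rfl, by simp, by simp⟩
  | succ a ih =>
  obtain ⟨s, d, hsd, hs, hd⟩ := ih (by omega)
  have extend : ∀ (f : ℕ → ℕ) (c : ℕ),
      (∀ v, N < v → ((∃ i < a, f i = v) ↔ v ≤ N + c)) → (f a ≤ N ∨ f a = N + c + 1) →
      ∀ v, N < v → ((∃ i < a + 1, f i = v) ↔ v ≤ N + if f a ≤ N then c else c + 1) := by
    intro f c hf hfa v hv
    rw [Nat.exists_lt_succ_right, hf v hv]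
    split_ifs <;> omega
  have hG : B a 0 N 0 ≤ N ∨ B a 0 N 0 = N + d + 1 := by
    by_contra! hG
    have h1 : ¬ B a 0 N 0 ≤ N + d := fun h => by
      obtain ⟨i, hi, e⟩ := (hd _ hG.1).2 h
      exact hB.col_ne 0 0 (by omega) (by omega) le_rfl hi.ne e
    rcases (hB.edge_isMex (a := a) (by omega) 0).2 (N + d + 1) (by omega) with
      ⟨i, hi, e⟩ | ⟨b, hb, e⟩ | h
    · have := (hd (N + d + 1) (by omega)).1 ⟨i, hi, e.symm⟩
      omega
    · have := hB.base_le (a := a) (b := b) (by omega) hb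
      omega
    · omega
  have hH : tail N B a ≤ N ∨ tail N B a = N + s + 1 := by
    by_contra! hH
    have h1 : ¬ tail N B a ≤ N + s := fun h => by
      obtain ⟨i, hi, e⟩ := (hs _ hH.1).2 h
      exact hi.ne (tail_injective e)
    have hGa : N < B a 0 N 0 := by
      by_contra h
      rw [hB.tail_eq_edge (by omega) (not_lt.1 h)] at hH
      omega
    rcases (tail_isMex N B a).2 (N + s + 1) (by omega) with
      ⟨i, hi, e⟩ | ⟨i, hi, hi', e⟩ | ⟨b, hb, e⟩
    · have := (hs (N + s + 1) (by omega)).1 ⟨i, hi, e.symm⟩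
      omega
    · rcases hsd.lt_or_eq with h | h
      · obtain ⟨j, hj, e'⟩ := (hd (N + s + 1) (by omega)).2 (by omega)
        exact hB.col_ne 0 0 (by omega) (by omega) le_rfl (by omega : i ≠ j) (e.symm.trans e'.symm)
      · exact hB.col_ne 0 0 (by omega) (by omega) le_rfl hi.ne
          (by omega : B a 0 N 0 = B i 0 N 0)
    · have := hB.base_le (a := a) (b := b) (by omega) hb
      omega
  refine ⟨_, _, ?_, extend _ s hs hH, extend _ d hd hG⟩
  have := hB.tail_eq_edge (a := a) (by omega)
  split_ifs <;> omega

theorem mem_of_lt_tail (hB : BlockRec N B) {a v : ℕ} (ha : a < N) (hv : v < tail N B a) :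
    (∃ b < N, v = B a 0 b 0) ∨ ∃ i < N, i ≠ a ∧ v = tail N B i := by
  rcases (tail_isMex N B a).2 v hv with ⟨i, hi, e⟩ | ⟨i, hi, hi', e⟩ | h
  · exact Or.inr ⟨i, by omega, by omega, e⟩
  · rcases le_or_gt v N with h | h
    · exact Or.inr ⟨i, hi', by omega, by rw [hB.tail_eq_edge hi' (e ▸ h)]; exact e⟩
    · obtain ⟨s, d, -, hs, -⟩ := hB.large_values (a + 1) (by omega)
      have := (hs (tail N B a) (by omega)).1 ⟨a, by omega, rfl⟩
      obtain ⟨j, hj, e'⟩ := (hs v h).2 (by omega)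
      refine Or.inr ⟨j, by omega, ?_, e'.symm⟩
      rintro rfl
      omega
  · exact Or.inl h

/-- The value of `B a q b p`, expressed through the values on the first block. -/
noncomputable def periodic (N : ℕ) (B : ℕ → ℕ → ℕ → ℕ → ℕ) (a q b p : ℕ) : ℕ :=
  if a = N then if b = N then 0 else if p = 0 then B b 0 N 0 else tail N B b
  else if b = N then if q = 0 then B a 0 N 0 else tail N B a
  else B a 0 b 0

theorem periodic_symm (hB : BlockRec N B) (a q b p : ℕ) :
    periodic N B a q b p = periodic N B b p a q := by
  unfold periodic
  split_ifs <;> first | rfl | exact hB.symm _ _ _ _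

theorem edge_pos (hB : BlockRec N B) {a : ℕ} (ha : a < N) : B a 0 N 0 ≠ 0 := by
  obtain ⟨b, hb, -, e⟩ := hB.exists_base_eq ha (Nat.zero_le a)
  exact fun h => hB.edge_ne_base ha hb (h.trans e.symm)

theorem base_isMex (hB : BlockRec N B) {a q b p : ℕ} (ha : a < N) (hb : b < N) :
    IsMex (B a 0 b 0) (BlockOpt N (periodic N B) a q b p) := by
  have hlo := hB.base_bounds (a := a) (b := b)
  have hhi := hB.base_eq ha hb
  have hval : ∀ {a q b p : ℕ}, a < N → b < N → periodic N B a q b p = B a 0 b 0 := by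
    intro a q b p ha hb
    simp [periodic, ha.ne, hb.ne]
  constructor
  · rintro (⟨a', h, e⟩ | ⟨a', h, h', q', -, e⟩ | ⟨b', h, e⟩ | ⟨b', h, h', p', -, e⟩ | h)
    · rw [hval (by omega) hb] at e
      exact hB.col_ne 0 0 ha.le (by omega) hb.le h.ne' e
    · rcases h'.lt_or_eq with h' | rfl
      · rw [hval h' hb] at e
        exact hB.col_ne 0 0 ha.le (by omega) hb.le h.ne e
      · rw [hB.symm] at e
        simp only [periodic, if_true, hb.ne, if_false] at e
        split_ifs at e
        · exact hB.edge_ne_base hb ha e.symm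
        · exact tail_ne_base ha e.symm
    · rw [hval ha (by omega)] at e
      exact hB.row_ne 0 0 ha.le hb.le (by omega) h.ne' e
    · rcases h'.lt_or_eq with h' | rfl
      · rw [hval ha h'] at e
        exact hB.row_ne 0 0 ha.le hb.le h'.le h.ne e
      · simp only [periodic, if_true, ha.ne, if_false] at e
        split_ifs at e
        · exact hB.edge_ne_base ha hb e.symm
        · exact tail_ne_base hb e.symm
    · unfold PathOpt at h
      omega
  · intro v hv
    rcases (hB.isMex a 0 b 0 ha.le hb.le).2 v hv with
      ⟨a', h, e⟩ | ⟨a', h, h', q', hq, -⟩ | ⟨b', h, e⟩ | ⟨b', h, h', q', hq, -⟩ | h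
    · exact Or.inl ⟨a', h, by rw [hval (by omega) hb, e]⟩
    · omega
    · exact Or.inr (Or.inr (Or.inl ⟨b', h, by rw [hval ha (by omega), e]⟩))
    · omega
    · by_cases hp : PathOpt N a q b p v
      · exact Or.inr (Or.inr (Or.inr (Or.inr hp)))
      · unfold PathOpt at h hp
        have hcases : (v ≤ a ∧ 0 < p) ∨ (v ≤ b ∧ 0 < q) := by omega
        rcases hcases with ⟨hva, hp⟩ | ⟨hvb, hq⟩
        · obtain ⟨b', hb', -, e⟩ := hB.exists_base_eq ha hva
          have hne : b' ≠ b := by rintro rfl; omega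
          rcases Nat.lt_or_gt_of_ne hne with hlt | hlt
          · exact Or.inr (Or.inr (Or.inl ⟨b', hlt, by rw [hval ha hb', e]⟩))
          · exact Or.inr (Or.inr (Or.inr (Or.inl ⟨b', hlt, hb'.le, p - 1, by omega,
              by rw [hval ha hb', e]⟩)))
        · obtain ⟨a', ha', -, e⟩ := hB.exists_base_eq hb hvb
          rw [hB.symm] at e
          have hne : a' ≠ a := by rintro rfl; omega
          rcases Nat.lt_or_gt_of_ne hne with hlt | hlt
          · exact Or.inl ⟨a', hlt, by rw [hval ha' hb, e]⟩
          · exact Or.inr (Or.inl ⟨a', hlt, ha'.le, q - 1, by omega, by rw [hval ha' hb, e]⟩)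

theorem edge_periodic_isMex (hB : BlockRec N B) {a q p : ℕ} (ha : a < N) :
    IsMex (periodic N B a q N p) (BlockOpt N (periodic N B) a q N p) := by
  have hbase : ∀ b < N, periodic N B a q b p = B a 0 b 0 := by
    intro b hb
    simp [periodic, ha.ne, hb.ne]
  obtain rfl | hq := Nat.eq_zero_or_pos q
  · have hedge : ∀ a' < N, periodic N B a' 0 N p = B a' 0 N 0 := by
      intro a' ha'
      simp [periodic, ha'.ne]
    rw [hedge a ha]
    obtain ⟨h1, h2⟩ := hB.edge_isMex ha 0
    constructor
    · rintro (⟨a', h, e⟩ | ⟨a', h, h', q', hq, -⟩ | ⟨b', h, e⟩ | ⟨b', h, h', -⟩ | h)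
      · exact h1 (Or.inl ⟨a', h, by rw [e, hedge a' (by omega)]⟩)
      · omega
      · exact h1 (Or.inr (Or.inl ⟨b', h, by rw [e, hbase b' h]⟩))
      · omega
      · refine h1 (Or.inr (Or.inr ?_))
        unfold PathOpt at h
        omega
    · intro v hv
      rcases h2 v hv with ⟨a', h, e⟩ | ⟨b', h, e⟩ | h
      · exact Or.inl ⟨a', h, by rw [e, hedge a' (by omega)]⟩
      · exact Or.inr (Or.inr (Or.inl ⟨b', h, by rw [e, hbase b' h]⟩))
      · refine Or.inr (Or.inr (Or.inr (Or.inr ?_)))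
        unfold PathOpt
        omega
  · have htail : ∀ a' < N, ∀ q, 0 < q → periodic N B a' q N p = tail N B a' := by
      intro a' ha' q hq
      simp [periodic, ha'.ne, hq.ne']
    rw [htail a ha q hq]
    have hlt := hB.lt_tail ha
    constructor
    · rintro (⟨a', h, e⟩ | ⟨a', h, h', q', rfl, e⟩ | ⟨b', h, e⟩ | ⟨b', h, h', -⟩ | h)
      · rw [htail a' (by omega) q hq] at e
        exact h.ne' (tail_injective e)
      · rcases h'.lt_or_eq with h' | rfl
        · obtain rfl | hq' := Nat.eq_zero_or_pos q'
          · simp only [periodic, h'.ne, if_true, if_false] at e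
            exact tail_ne_edge h h' e
          · rw [htail a' h' q' hq'] at e
            exact h.ne (tail_injective e)
        · simp only [periodic, if_true] at e
          omega
      · rw [hbase b' h] at e
        exact tail_ne_base h e
      · omega
      · unfold PathOpt at h
        omega
    · intro v hv
      obtain ⟨q, rfl⟩ : ∃ q', q = q' + 1 := ⟨q - 1, by omega⟩
      obtain rfl | hq' := Nat.eq_zero_or_pos q
      · rcases (tail_isMex N B a).2 v hv with ⟨i, hi, e⟩ | ⟨i, hi, hi', e⟩ | ⟨b, hb, e⟩
        · exact Or.inl ⟨i, hi, by rw [htail i (by omega) _ hq, e]⟩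
        · exact Or.inr (Or.inl ⟨i, hi, hi'.le, 0, rfl, by simp [periodic, hi'.ne, e]⟩)
        · exact Or.inr (Or.inr (Or.inl ⟨b, hb, by rw [e, hbase b hb]⟩))
      · rcases hB.mem_of_lt_tail ha hv with ⟨b, hb, e⟩ | ⟨i, hi, hne, e⟩
        · exact Or.inr (Or.inr (Or.inl ⟨b, hb, by rw [e, hbase b hb]⟩))
        · rcases Nat.lt_or_gt_of_ne hne with hlt | hlt
          · exact Or.inl ⟨i, hlt, by rw [htail i hi _ hq, e]⟩
          · exact Or.inr (Or.inl ⟨i, hlt, hi.le, q, rfl, by rw [htail i hi _ hq', e]⟩)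

theorem corner_isMex (hB : BlockRec N B) {q p : ℕ} :
    IsMex 0 (BlockOpt N (periodic N B) N q N p) := by
  have hne : ∀ a < N, ∀ q p, periodic N B a q N p ≠ 0 := by
    intro a ha q p
    simp only [periodic, ha.ne, if_true, if_false]
    split_ifs
    · exact hB.edge_pos ha
    · have := hB.lt_tail ha
      omega
  have hpos := hB.pos
  refine ⟨?_, fun v hv => by omega⟩
  rintro (⟨a', h, e⟩ | ⟨a', h, h', -⟩ | ⟨b', h, e⟩ | ⟨b', h, h', -⟩ | h)
  · exact hne a' h q p e.symm
  · omega
  · rw [hB.periodic_symm] at e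
    exact hne b' h p q e.symm
  · omega
  · unfold PathOpt at h
    omega

theorem _root_.BlockOpt.symm {a q b p v : ℕ} {f : ℕ → ℕ → ℕ → ℕ → ℕ}
    (hf : ∀ a q b p, f a q b p = f b p a q) :
    BlockOpt N f a q b p v ↔ BlockOpt N f b p a q v := by
  have hp : PathOpt N a q b p v ↔ PathOpt N b p a q v := by
    unfold PathOpt
    omega
  simp only [BlockOpt, hp, hf a q, hf _ _ b p]
  exact eq_iff_iff.1 (by ac_rfl)

theorem periodic_isMex (hB : BlockRec N B) {a q b p : ℕ} (ha : a ≤ N) (hb : b ≤ N) :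
    IsMex (periodic N B a q b p) (BlockOpt N (periodic N B) a q b p) := by
  rcases ha.lt_or_eq with ha | rfl
  · rcases hb.lt_or_eq with hb | rfl
    · simpa [periodic, ha.ne, hb.ne] using hB.base_isMex ha hb
    · exact hB.edge_periodic_isMex ha
  · rcases hb.lt_or_eq with hb | rfl
    · have h := hB.edge_periodic_isMex (q := p) (p := q) hb
      rw [hB.periodic_symm]
      simpa only [IsMex, BlockOpt.symm hB.periodic_symm (a := b)] using h
    · simpa [periodic] using hB.corner_isMex

theorem eq_periodic (hB : BlockRec N B) (m n : ℕ) : ∀ a q b p, q + p = m → a + b = n → a ≤ N →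
    b ≤ N → B a q b p = periodic N B a q b p := by
  induction m using Nat.strong_induction_on generalizing n with
  | _ m ihm =>
  induction n using Nat.strong_induction_on with
  | _ n ihn =>
  intro a q b p hm hn ha hb
  refine (hB.isMex a q b p ha hb).unique ?_
  have h := hB.periodic_isMex (q := q) (p := p) ha hb
  convert h using 1
  funext v
  simp only [BlockOpt, eq_iff_iff]
  refine or_congr ?_ (or_congr ?_ (or_congr ?_ (or_congr ?_ Iff.rfl)))
  · refine exists_congr fun a' => and_congr_right fun h => ?_
    rw [ihn (a' + b) (by omega) a' q b p hm rfl (by omega) hb]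
  · refine exists_congr fun a' => and_congr_right fun h => and_congr_right fun h' =>
      exists_congr fun q' => and_congr_right fun h'' => ?_
    rw [ihm (q' + p) (by omega) (a' + b) a' q' b p rfl rfl h' hb]
  · refine exists_congr fun b' => and_congr_right fun h => ?_
    rw [ihn (a + b') (by omega) a q b' p hm rfl ha (by omega)]
  · refine exists_congr fun b' => and_congr_right fun h => and_congr_right fun h' =>
      exists_congr fun p' => and_congr_right fun h'' => ?_
    rw [ihm (q + p') (by omega) (a + b') a q b' p' rfl rfl ha h']

end BlockRec

/-- The Grundy values of the options of `S(1, k, l)`, where `g k l` is the Grundy value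
of `S(1, k, l)`. -/
def StarOpt (N : ℕ) (g : ℕ → ℕ → ℕ) (k l v : ℕ) : Prop :=
  (∃ i < k, k ≤ i + N ∧ v = g i l) ∨ (∃ j < l, l ≤ j + N ∧ v = g k j) ∨
  v = (k + l + 1) % (N + 1) ∨
  ∃ m, (m ≤ k ∨ m ≤ l) ∧ k + l + 2 ≤ m + N ∧ v = m % (N + 1)

theorem StarOpt.symm {N k l v : ℕ} {f g : ℕ → ℕ → ℕ} (hl : ∀ i < k, f i l = g l i)
    (hk : ∀ j < l, f k j = g j k) : StarOpt N f k l v ↔ StarOpt N g l k v := by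
  have h1 : (∃ i < k, k ≤ i + N ∧ v = f i l) ↔ ∃ i < k, k ≤ i + N ∧ v = g l i :=
    exists_congr fun i => and_congr_right fun h => by rw [hl i h]
  have h2 : (∃ j < l, l ≤ j + N ∧ v = f k j) ↔ ∃ j < l, l ≤ j + N ∧ v = g j k :=
    exists_congr fun j => and_congr_right fun h => by rw [hk j h]
  simp only [StarOpt, h1, h2, add_comm l k, or_comm (a := _ ≤ l)]
  exact eq_iff_iff.1 (by ac_rfl)

theorem star_symm {N : ℕ} {g : ℕ → ℕ → ℕ} (hg : ∀ k l, IsMex (g k l) (StarOpt N g k l))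
    (n : ℕ) : ∀ k l, k + l = n → g k l = g l k := by
  induction n using Nat.strong_induction_on with
  | _ n ih =>
  intro k l hn
  refine (hg k l).unique ?_
  have h : ∀ v, StarOpt N g k l v ↔ StarOpt N g l k v := fun v =>
    StarOpt.symm (fun i hi => ih (i + l) (by omega) i l rfl)
      fun j hj => ih (k + j) (by omega) k j rfl
  simpa only [IsMex, h] using hg l k

theorem exists_lt_block_iff {N a q : ℕ} (ha : a ≤ N) (P : ℕ → Prop) :
    (∃ i < a + (N + 1) * q, a + (N + 1) * q ≤ i + N ∧ P i) ↔
      (∃ a' < a, P (a' + (N + 1) * q)) ∨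
      ∃ a', a < a' ∧ a' ≤ N ∧ ∃ q', q = q' + 1 ∧ P (a' + (N + 1) * q') := by
  constructor
  · rintro ⟨i, hi, hi', h⟩
    rcases le_or_gt ((N + 1) * q) i with hq | hq
    · exact Or.inl ⟨i - (N + 1) * q, by omega, by rwa [Nat.sub_add_cancel hq]⟩
    · obtain _ | q := q
      · omega
      · rw [Nat.mul_succ] at *
        exact Or.inr ⟨i - (N + 1) * q, by omega, by omega, q, rfl,
          by rwa [Nat.sub_add_cancel (by omega)]⟩
  · rintro (⟨a', h, hP⟩ | ⟨a', h, h', q', rfl, hP⟩)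
    · exact ⟨_, by omega, by omega, hP⟩
    · rw [Nat.mul_succ]
      exact ⟨_, by omega, by omega, hP⟩

theorem eq_mod_iff {N v m : ℕ} : v = m % (N + 1) ↔ v ≤ N ∧ ∃ c, m = v + (N + 1) * c := by
  constructor
  · rintro rfl
    exact ⟨Nat.lt_succ_iff.1 (Nat.mod_lt _ N.succ_pos), m / (N + 1), (Nat.mod_add_div _ _).symm⟩
  · rintro ⟨hv, c, rfl⟩
    rw [Nat.add_mul_mod_self_left, Nat.mod_eq_of_lt (by omega)]

theorem exists_branch_iff {N a b p v : ℕ} (ha : a ≤ N) (hb : b ≤ N) :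
    (∃ m, (m ≤ a ∨ m ≤ b + (N + 1) * (p + 1)) ∧ a + (b + (N + 1) * (p + 1)) + 2 ≤ m + N ∧
      v = m % (N + 1)) ↔
    v ≤ N ∧ ((v ≤ b ∧ a + b + 2 ≤ v + N) ∨ (b < v ∧ a + b + 3 ≤ v)) := by
  have hp : (N + 1) * (p + 1) = (N + 1) * p + (N + 1) := Nat.mul_succ _ _
  constructor
  · rintro ⟨m, hm, hm', h⟩
    obtain ⟨hv, c, rfl⟩ := eq_mod_iff.1 h
    refine ⟨hv, ?_⟩
    have h1 : c ≤ p → (N + 1) * c ≤ (N + 1) * p := fun h => Nat.mul_le_mul_left _ h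
    have h2 : p + 1 ≤ c → (N + 1) * (p + 1) ≤ (N + 1) * c := fun h => Nat.mul_le_mul_left _ h
    have h3 : p + 2 ≤ c → (N + 1) * (p + 2) ≤ (N + 1) * c := fun h => Nat.mul_le_mul_left _ h
    have h4 : (N + 1) * (p + 2) = (N + 1) * (p + 1) + (N + 1) := Nat.mul_succ _ _
    have h5 : c + 1 ≤ p → (N + 1) * (c + 1) ≤ (N + 1) * p := fun h => Nat.mul_le_mul_left _ h
    have h6 : (N + 1) * (c + 1) = (N + 1) * c + (N + 1) := Nat.mul_succ _ _
    have h7 : c = p → (N + 1) * c = (N + 1) * p := fun h => by rw [h]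
    have h8 : c = p + 1 → (N + 1) * c = (N + 1) * (p + 1) := fun h => by rw [h]
    omega
  · rintro ⟨hv, h | h⟩
    · exact ⟨v + (N + 1) * (p + 1), by omega, by omega, eq_mod_iff.2 ⟨hv, _, rfl⟩⟩
    · exact ⟨v + (N + 1) * p, by omega, by omega, eq_mod_iff.2 ⟨hv, _, rfl⟩⟩

theorem pathOpt_iff {N a q b p v : ℕ} (ha : a ≤ N) (hb : b ≤ N) :
    (v = (a + (N + 1) * q + (b + (N + 1) * p) + 1) % (N + 1) ∨
      ∃ m, (m ≤ a + (N + 1) * q ∨ m ≤ b + (N + 1) * p) ∧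
        a + (N + 1) * q + (b + (N + 1) * p) + 2 ≤ m + N ∧ v = m % (N + 1)) ↔
    PathOpt N a q b p v := by
  have h1 : v = (a + (N + 1) * q + (b + (N + 1) * p) + 1) % (N + 1) ↔
      v ≤ N ∧ (v = a + b + 1 ∨ v + N = a + b) := by
    have e : a + (N + 1) * q + (b + (N + 1) * p) + 1 = a + b + 1 + (N + 1) * (q + p) := by ring
    rw [e, Nat.add_mul_mod_self_left]
    rcases le_or_gt (a + b + 1) N with h | h
    · rw [Nat.mod_eq_of_lt (by omega)]
      omega
    · rw [Nat.mod_eq_sub_mod (by omega), Nat.mod_eq_of_lt (by omega)]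
      omega
  rw [h1]
  unfold PathOpt
  rcases q with _ | q <;> rcases p with _ | p
  · simp only [Nat.mul_zero, add_zero, true_and]
    have : (∃ m, (m ≤ a ∨ m ≤ b) ∧ a + b + 2 ≤ m + N ∧ v = m % (N + 1)) ↔
        (v ≤ a ∨ v ≤ b) ∧ a + b + 2 ≤ v + N := by
      constructor
      · rintro ⟨m, hm, hm', h⟩
        rw [Nat.mod_eq_of_lt (by omega)] at h
        omega
      · exact fun h => ⟨v, h.1, h.2, (Nat.mod_eq_of_lt (by omega)).symm⟩
    rw [this]
    omega
  · simp only [Nat.mul_zero, add_zero, true_and]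
    rw [exists_branch_iff ha hb]
    omega
  · have := exists_branch_iff (p := q) (v := v) hb ha
    simp only [Nat.mul_zero, add_zero, true_and, add_comm _ b, or_comm (a := _ ≤ b)] at this ⊢
    rw [this]
    omega
  · rw [Nat.mul_succ, Nat.mul_succ]
    constructor
    · rintro (h | ⟨m, hm, hm', -⟩) <;> omega
    · omega

theorem blockRec_of_star {N : ℕ} (hN : 0 < N) {g : ℕ → ℕ → ℕ}
    (hg : ∀ k l, IsMex (g k l) (StarOpt N g k l)) :
    BlockRec N (fun a q b p => g (a + (N + 1) * q) (b + (N + 1) * p)) where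
  pos := hN
  symm _ _ _ _ := star_symm hg _ _ _ rfl
  isMex a q b p ha hb := by
    convert hg (a + (N + 1) * q) (b + (N + 1) * p) using 1
    funext v
    rw [StarOpt, BlockOpt, ← pathOpt_iff ha hb,
      exists_lt_block_iff ha (fun i => v = g i (b + (N + 1) * p)),
      exists_lt_block_iff hb (fun j => v = g (a + (N + 1) * q) j)]
    simp only [or_assoc]

/-- A function satisfying the Grundy recursion of the stars `S(1, k, l)` is, in the columns
`l ≡ N` modulo `N + 1`, periodic in `k > N`, and independent of the column. -/
theorem star_periodic {N : ℕ} (hN : 0 < N) {g : ℕ → ℕ → ℕ}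
    (hg : ∀ k l, IsMex (g k l) (StarOpt N g k l)) {k l : ℕ} (hk : N < k)
    (hl : l % (N + 1) = N) : g k l = g (k % (N + 1) + N + 1) N := by
  have hB := blockRec_of_star hN hg
  have ha : k % (N + 1) ≤ N := Nat.lt_succ_iff.1 (Nat.mod_lt _ N.succ_pos)
  have hq : k / (N + 1) ≠ 0 := (Nat.div_pos hk N.succ_pos).ne'
  have h1 := hB.eq_periodic _ _ (k % (N + 1)) (k / (N + 1)) N (l / (N + 1)) rfl rfl ha le_rfl
  have h2 := hB.eq_periodic _ _ (k % (N + 1)) 1 N 0 rfl rfl ha le_rfl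
  have h3 := Nat.mod_add_div l (N + 1)
  rw [hl] at h3
  simp only [Nat.mod_add_div, h3, mul_one, mul_zero, add_zero] at h1 h2
  rw [h1, add_assoc, h2]
  simp [BlockRec.periodic, hq]

theorem ConnOn.closed {V : Type*} {G : SimpleGraph V} {s : Set V} (h : ConnOn G s)
    {P : V → Prop} (hP : ∀ u ∈ s, ∀ v ∈ s, G.Adj u v → P u → P v) {x y : V} (hx : x ∈ s)
    (hy : y ∈ s) (hPx : P x) : P y := by
  obtain ⟨w⟩ := h.preconnected ⟨x, hx⟩ ⟨y, hy⟩
  have key : ∀ u v : s, (G.induce s).Walk u v → P u → P v := by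
    intro u v w
    induction w with
    | nil => exact id
    | cons h _ ih => exact fun hu => ih (hP _ (Subtype.coe_prop _) _ (Subtype.coe_prop _) h hu)
  exact key _ _ w hPx

theorem connOn_singleton {V : Type*} (G : SimpleGraph V) (v : V) : ConnOn G {v} := by
  have : Nonempty ({v} : Set V) := ⟨⟨v, rfl⟩⟩
  exact SimpleGraph.Connected.of_subsingleton

theorem ConnOn.insert {V : Type*} {G : SimpleGraph V} {s : Set V} (h : ConnOn G s) {u v : V}
    (hu : u ∈ s) (huv : G.Adj v u) : ConnOn G (insert v s) := by
  have e : Insert.insert v s = {v, u} ∪ s := by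
    rw [Set.insert_union, Set.singleton_union, Set.insert_eq_of_mem hu]
  rw [e]
  exact SimpleGraph.induce_union_connected
    (SimpleGraph.induce_pair_connected_of_adj huv).preconnected h.preconnected
    ⟨u, by simp, hu⟩

theorem ConnOn.nonempty {V : Type*} {G : SimpleGraph V} {s : Set V} (h : ConnOn G s) :
    s.Nonempty :=
  Set.nonempty_coe_sort.1 (SimpleGraph.Connected.nonempty h)

theorem connOn_image {V W : Type*} {G : SimpleGraph V} {H : SimpleGraph W} (f : G ↪g H)
    (s : Set V) : ConnOn H (f '' s) ↔ ConnOn G s := by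
  let e : G.induce s ≃g H.induce (f '' s) :=
    { toEquiv := Equiv.Set.image f s f.injective
      map_rel_iff' := f.map_adj_iff }
  exact e.connected_iff.symm

theorem isMex_csgGrundy {V : Type*} [DecidableEq V] (G : SimpleGraph V) (L : Set ℕ)
    (s : Finset V) : IsMex (csgGrundy G L s)
      (fun v => ∃ t, CsgMove G L s t ∧ v = csgGrundy G L t) := by
  have hfin : (Set.range fun t : {t : Finset V // CsgMove G L s t} =>
      csgGrundy G L t.1).Finite := by
    refine (s.powerset.image (csgGrundy G L)).finite_toSet.subset ?_
    rintro _ ⟨t, rfl⟩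
    exact Finset.mem_coe.2 (Finset.mem_image_of_mem _ (Finset.mem_powerset.2 t.2.1))
  have h := isMex_mex hfin
  rw [← csgGrundy] at h
  convert h using 1
  funext v
  simp [eq_comm]

theorem csgMove_union {V : Type*} [DecidableEq V] {G : SimpleGraph V} {L : Set ℕ}
    {s t u : Finset V} (hs : t ∪ u = s) (hd : Disjoint t u) (hL : u.card ∈ L)
    (hu : ConnOn G (u : Set V)) (ht : t = ∅ ∨ ConnOn G (t : Set V)) : CsgMove G L s t := by
  have e : s \ t = u := by
    rw [← hs, Finset.union_sdiff_left, Finset.sdiff_eq_self_of_disjoint hd.symm]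
  refine ⟨hs ▸ Finset.subset_union_left, ?_, ?_, ?_, ht⟩ <;> rw [e]
  · exact Finset.coe_nonempty.1 hu.nonempty
  · exact hL
  · exact hu

theorem csgMove_map {V W : Type*} [DecidableEq V] [DecidableEq W] {G : SimpleGraph V}
    {H : SimpleGraph W} (f : G ↪g H) (L : Set ℕ) (s t : Finset V) :
    CsgMove H L (s.map f.toEmbedding) (t.map f.toEmbedding) ↔ CsgMove G L s t := by
  have hc : ∀ u : Finset V, ConnOn H (u.map f.toEmbedding : Set W) ↔ ConnOn G (u : Set V) := by
    intro u
    rw [Finset.coe_map]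
    exact connOn_image f u
  simp only [CsgMove, Finset.map_subset_map, ← Finset.map_sdiff, Finset.map_nonempty,
    Finset.card_map, Finset.map_eq_empty, hc]

theorem csgGrundy_map {V W : Type*} [DecidableEq V] [DecidableEq W] {G : SimpleGraph V}
    {H : SimpleGraph W} (f : G ↪g H) (L : Set ℕ) (s : Finset V) :
    csgGrundy H L (s.map f.toEmbedding) = csgGrundy G L s := by
  induction s using Finset.strongInduction with
  | H s ih =>
  refine (isMex_csgGrundy H L _).unique ?_
  have h := isMex_csgGrundy G L s
  have ih' : ∀ t, CsgMove G L s t →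
      csgGrundy H L (t.map f.toEmbedding) = csgGrundy G L t := by
    intro t ht
    refine ih t (ht.1.ssubset_of_ne ?_)
    rintro rfl
    simpa using ht.2.1
  convert h using 1
  funext v
  simp only [eq_iff_iff]
  constructor
  · rintro ⟨t', ht', rfl⟩
    obtain ⟨t, -, rfl⟩ := Finset.subset_map_iff.1 ht'.1
    have ht := (csgMove_map f L s t).1 ht'
    exact ⟨t, ht, ih' t ht⟩
  · rintro ⟨t, ht, rfl⟩
    exact ⟨_, (csgMove_map f L s t).2 ht, (ih' t ht).symm⟩

/-- The path on the integers with a leaf `none` attached at `0`. -/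
def leafedLine : SimpleGraph (Option ℤ) :=
  SimpleGraph.fromRel fun a b =>
    match a, b with
    | none, some y => y = 0
    | some x, some y => x + 1 = y
    | _, _ => False

namespace leafedLine

@[simp] theorem adj_some_some (x y : ℤ) :
    leafedLine.Adj (some x) (some y) ↔ x + 1 = y ∨ y + 1 = x := by
  simp only [leafedLine, SimpleGraph.fromRel_adj, ne_eq, Option.some.injEq, and_iff_right_iff_imp]
  omega

@[simp] theorem adj_none_some (y : ℤ) : leafedLine.Adj none (some y) ↔ y = 0 := by
  simp [leafedLine]

@[simp] theorem adj_some_none (y : ℤ) : leafedLine.Adj (some y) none ↔ y = 0 := by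
  simp [leafedLine]

/-- The segment of length `r` starting at `c`. -/
noncomputable def seg (c : ℤ) (r : ℕ) : Finset (Option ℤ) :=
  (Finset.Ico c (c + r)).map Function.Embedding.some

/-- A copy of the star `S(1, k, l)`. -/
noncomputable def star (k l : ℕ) : Finset (Option ℤ) := insert none (seg (-k) (k + l + 1))

@[simp] theorem some_mem_seg {c x : ℤ} {r : ℕ} : some x ∈ seg c r ↔ c ≤ x ∧ x < c + r := by
  simp [seg]

@[simp] theorem none_notMem_seg {c : ℤ} {r : ℕ} : none ∉ seg c r := by
  simp [seg]

@[simp] theorem card_seg (c : ℤ) (r : ℕ) : (seg c r).card = r := by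
  simp [seg]

@[simp] theorem none_mem_star {k l : ℕ} : none ∈ star k l := by
  simp [star]

@[simp] theorem some_mem_star {k l : ℕ} {x : ℤ} : some x ∈ star k l ↔ -k ≤ x ∧ x ≤ l := by
  simp only [star, Finset.mem_insert, reduceCtorEq, false_or, some_mem_seg]
  omega

@[simp] theorem card_star (k l : ℕ) : (star k l).card = k + l + 2 := by
  simp [star]

theorem connOn_seg (c : ℤ) {r : ℕ} (hr : 0 < r) : ConnOn leafedLine (seg c r : Set (Option ℤ)) := by
  induction r, hr using Nat.le_induction with
  | base =>
    convert connOn_singleton leafedLine (some c)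
    ext (_ | x)
    · simp
    · simp
      omega
  | succ r hr ih =>
    have e : (seg c (r + 1) : Set (Option ℤ)) = insert (some (c + r)) (seg c r : Set _) := by
      ext (_ | x)
      · simp
      · simp
        omega
    rw [e]
    exact ih.insert (u := some (c + r - 1)) (by simp; omega) (by simp)

theorem seg_eq_empty_or_connOn (c : ℤ) (r : ℕ) :
    seg c r = ∅ ∨ ConnOn leafedLine (seg c r : Set (Option ℤ)) := by
  rcases Nat.eq_zero_or_pos r with rfl | hr
  · simp [seg]
  · exact Or.inr (connOn_seg c hr)

theorem connOn_star (k l : ℕ) : ConnOn leafedLine (star k l : Set (Option ℤ)) := by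
  rw [star, Finset.coe_insert]
  exact (connOn_seg _ (by omega)).insert (u := some 0) (by simp) (by simp)

theorem mem_of_connOn {s : Finset (Option ℤ)} (h : ConnOn leafedLine (s : Set (Option ℤ)))
    {x y z : ℤ} (hx : some x ∈ s) (hz : some z ∈ s) (hxy : x ≤ y) (hyz : y ≤ z) :
    some y ∈ s := by
  by_contra hy
  have key := h.closed (P := fun v => v.getD 0 < y) ?_ hx hz ?_
  · simp only [Option.getD_some] at key
    omega
  · rintro (_ | u) hu (_ | v) hv huv h
    · exact h
    · rw [adj_none_some] at huv
      simpa [huv] using h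
    · rw [adj_some_none] at huv
      simpa [huv] using h
    · rw [adj_some_some] at huv
      have : v ≠ y := by
        rintro rfl
        exact hy hv
      simp only [Option.getD_some] at h ⊢
      omega
  · have : x ≠ y := by
      rintro rfl
      exact hy hx
    simp only [Option.getD_some]
    omega

theorem zero_mem_of_connOn {s : Finset (Option ℤ)} (h : ConnOn leafedLine (s : Set (Option ℤ)))
    (hn : none ∈ s) {x : ℤ} (hx : some x ∈ s) : some 0 ∈ s := by
  by_contra h0
  have key := h.closed (P := fun v => v = none) ?_ hn hx rfl
  · simp at key
  · rintro u hu (_ | v) hv huv rfl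
    · rfl
    · rw [adj_none_some] at huv
      subst huv
      exact absurd hv h0

theorem exists_eq_seg {s : Finset (Option ℤ)} (h : ConnOn leafedLine (s : Set (Option ℤ)))
    (hn : none ∉ s) : ∃ c r, 0 < r ∧ s = seg c r := by
  have hs : s.eraseNone.map Function.Embedding.some = s := by
    rw [Finset.map_some_eraseNone, Finset.erase_eq_of_notMem hn]
  have hne : s.eraseNone.Nonempty := by
    rw [← Finset.map_nonempty (f := Function.Embedding.some), hs]
    exact Finset.coe_nonempty.1 h.nonempty
  have hmin := Finset.mem_eraseNone.1 (s.eraseNone.min'_mem hne)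
  have hmax := Finset.mem_eraseNone.1 (s.eraseNone.max'_mem hne)
  have hle := s.eraseNone.min'_le_max' hne
  refine ⟨s.eraseNone.min' hne, (s.eraseNone.max' hne + 1 - s.eraseNone.min' hne).toNat,
    by omega, ?_⟩
  ext (_ | x)
  · simpa using hn
  · rw [some_mem_seg]
    constructor
    · intro hx
      have h1 := s.eraseNone.min'_le x (Finset.mem_eraseNone.2 hx)
      have h2 := s.eraseNone.le_max' x (Finset.mem_eraseNone.2 hx)
      omega
    · intro hx
      exact mem_of_connOn h hmin hmax hx.1 (by omega)

theorem csgGrundy_seg (N n : ℕ) : ∀ c, csgGrundy leafedLine (Set.Icc 1 N) (seg c n) =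
    n % (N + 1) := by
  induction n using Nat.strong_induction_on with
  | _ n ih =>
  intro c
  refine (isMex_csgGrundy _ _ _).unique ⟨?_, fun v hv => ?_⟩
  · rintro ⟨t, ⟨hts, -, hL, hu, ht⟩, e⟩
    obtain ⟨m, c', rfl⟩ : ∃ m c', t = seg c' m := by
      rcases ht with rfl | ht
      · exact ⟨0, 0, by simp [seg]⟩
      · obtain ⟨c', m, -, h⟩ := exists_eq_seg ht fun h => none_notMem_seg (hts h)
        exact ⟨m, c', h⟩
    rw [Finset.card_sdiff_of_subset hts, card_seg, card_seg] at hL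
    have hmn := Finset.card_le_card hts
    rw [card_seg, card_seg] at hmn
    rw [Set.mem_Icc] at hL
    rw [ih m (by omega)] at e
    have hdvd := (Nat.modEq_iff_dvd' hmn).1 (Eq.symm e)
    have := Nat.le_of_dvd (by omega) hdvd
    omega
  · have hn := Nat.mod_le n (N + 1)
    have hlt : n % (N + 1) < N + 1 := Nat.mod_lt _ (by omega)
    obtain ⟨r, hr⟩ : ∃ r, n % (N + 1) = v + r := ⟨_, (Nat.add_sub_cancel' hv.le).symm⟩
    refine ⟨seg c (n - r), csgMove_union (u := seg (c + (n - r : ℕ)) r) ?_ ?_ ?_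
      (connOn_seg _ (by omega)) (seg_eq_empty_or_connOn _ _), ?_⟩
    · ext (_ | x)
      · simp
      · simp
        omega
    · rw [Finset.disjoint_left]
      rintro (_ | x)
      · simp
      · simp
        omega
    · rw [card_seg, Set.mem_Icc]
      omega
    · rw [ih _ (by omega)]
      have := Nat.mod_add_div n (N + 1)
      rw [show n - r = v + (N + 1) * (n / (N + 1)) by omega, Nat.add_mul_mod_self_left,
        Nat.mod_eq_of_lt (by omega)]

theorem csgGrundy_none {N : ℕ} (hN : 0 < N) :
    csgGrundy leafedLine (Set.Icc 1 N) {none} = 1 := by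
  have hempty : csgGrundy leafedLine (Set.Icc 1 N) ∅ = 0 := by
    simpa [seg] using csgGrundy_seg N 0 0
  refine (isMex_csgGrundy _ _ _).unique ⟨?_, fun v hv => ?_⟩
  · rintro ⟨t, ⟨hts, hne, -⟩, e⟩
    rcases Finset.subset_singleton_iff.1 hts with rfl | rfl
    · omega
    · simp at hne
  · refine ⟨∅, csgMove_union (u := {none}) (by simp) (by simp) (by simp; omega) ?_
      (Or.inl rfl), by omega⟩
    rw [Finset.coe_singleton]
    exact connOn_singleton _ _

theorem split_star {k l : ℕ} {A B : Finset (Option ℤ)} (hAB : A ∪ B = star k l)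
    (hd : Disjoint A B) (hA : ConnOn leafedLine (A : Set (Option ℤ)))
    (hB : ConnOn leafedLine (B : Set (Option ℤ))) (hn : none ∈ A) :
    (∃ i < k, A = star i l ∧ ∃ c, B = seg c (k - i)) ∨
    (∃ j < l, A = star k j ∧ ∃ c, B = seg c (l - j)) ∨
    (A = {none} ∧ ∃ c, B = seg c (k + l + 1)) := by
  have hnB : none ∉ B := Finset.disjoint_left.1 hd hn
  obtain ⟨c, r, hr, rfl⟩ := exists_eq_seg hB hnB
  have hmem : ∀ x : ℤ, some x ∈ A ↔ (-k ≤ x ∧ x ≤ l) ∧ ¬ (c ≤ x ∧ x < c + r) := by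
    intro x
    have h1 : some x ∈ A ∪ seg c r ↔ some x ∈ star k l := by rw [hAB]
    have h2 : some x ∈ A → some x ∉ seg c r := fun h => Finset.disjoint_left.1 hd h
    rw [Finset.mem_union, some_mem_star, some_mem_seg] at h1
    rw [some_mem_seg] at h2
    tauto
  have hsub : ∀ x : ℤ, c ≤ x → x < c + r → -k ≤ x ∧ x ≤ l := by
    intro x h h'
    rw [← some_mem_star, ← hAB, Finset.mem_union, some_mem_seg]
    exact Or.inr ⟨h, h'⟩
  have hc1 := hsub c (by omega) (by omega)
  have hc2 := hsub (c + r - 1) (by omega) (by omega)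
  have hzero : ∀ x : ℤ, some x ∈ A → some 0 ∈ A := fun x => zero_mem_of_connOn hA hn
  by_cases h0 : some 0 ∈ A
  · have h0' := (hmem 0).1 h0
    rcases lt_or_ge 0 c with hc | hc
    · have hcl : c + r = l + 1 := by
        by_contra hne
        have hl := (hmem l).2 (by omega)
        have := (hmem c).1 (mem_of_connOn hA h0 hl hc.le (by omega))
        omega
      refine Or.inr (Or.inl ⟨l - r, by omega, ?_, c, by congr 1; omega⟩)
      ext (_ | x)
      · simpa using hn
      · rw [hmem, some_mem_star]
        omega
    · have hck : c = -k := by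
        by_contra hne
        have hk := (hmem (-k)).2 (by omega)
        have := (hmem c).1 (mem_of_connOn hA hk h0 (by omega) (by omega))
        omega
      refine Or.inl ⟨k - r, by omega, ?_, c, by congr 1; omega⟩
      ext (_ | x)
      · simpa using hn
      · rw [hmem, some_mem_star]
        omega
  · have hsome : ∀ x : ℤ, some x ∉ A := fun x hx => h0 (hzero x hx)
    have hk := (not_congr (hmem (-k))).1 (hsome _)
    have hl := (not_congr (hmem l)).1 (hsome _)
    refine Or.inr (Or.inr ⟨?_, c, by congr 1; omega⟩)
    ext (_ | x)
    · simpa using hn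
    · simpa using hsome x

theorem isMex_star {N : ℕ} (hN : 0 < N) (k l : ℕ) :
    IsMex (csgGrundy leafedLine (Set.Icc 1 N) (star k l))
      (StarOpt N (fun k l => csgGrundy leafedLine (Set.Icc 1 N) (star k l)) k l) := by
  convert isMex_csgGrundy leafedLine (Set.Icc 1 N) (star k l) using 1
  funext v
  rw [eq_iff_iff]
  constructor
  · rintro (⟨i, hi, hN', rfl⟩ | ⟨j, hj, hN', rfl⟩ | rfl | ⟨m, hm, hN', rfl⟩)
    · refine ⟨star i l, csgMove_union (u := seg (-k) (k - i)) ?_ ?_ ?_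
        (connOn_seg _ (by omega)) (Or.inr (connOn_star _ _)), rfl⟩
      · ext (_ | x)
        · simp
        · rw [Finset.mem_union, some_mem_star, some_mem_star, some_mem_seg]
          omega
      · rw [Finset.disjoint_left]
        rintro (_ | x)
        · simp
        · rw [some_mem_star, some_mem_seg]
          omega
      · rw [card_seg, Set.mem_Icc]
        omega
    · refine ⟨star k j, csgMove_union (u := seg (j + 1) (l - j)) ?_ ?_ ?_
        (connOn_seg _ (by omega)) (Or.inr (connOn_star _ _)), rfl⟩
      · ext (_ | x)
        · simp
        · rw [Finset.mem_union, some_mem_star, some_mem_star, some_mem_seg]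
          omega
      · rw [Finset.disjoint_left]
        rintro (_ | x)
        · simp
        · rw [some_mem_star, some_mem_seg]
          omega
      · rw [card_seg, Set.mem_Icc]
        omega
    · refine ⟨seg (-k) (k + l + 1), csgMove_union (u := {none}) ?_ ?_ ?_ ?_
        (Or.inr (connOn_seg _ (by omega))), (csgGrundy_seg _ _ _).symm⟩
      · rw [Finset.union_comm]
        rfl
      · simp
      · simp
        omega
      · rw [Finset.coe_singleton]
        exact connOn_singleton _ _
    · rcases hm with hm | hm
      · refine ⟨seg (-k) m, csgMove_union (u := star (k - m) l) ?_ ?_ ?_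
          (connOn_star _ _) (seg_eq_empty_or_connOn _ _), (csgGrundy_seg _ _ _).symm⟩
        · ext (_ | x)
          · simp
          · rw [Finset.mem_union, some_mem_star, some_mem_star, some_mem_seg]
            omega
        · rw [Finset.disjoint_left]
          rintro (_ | x)
          · simp
          · rw [some_mem_star, some_mem_seg]
            omega
        · rw [card_star, Set.mem_Icc]
          omega
      · refine ⟨seg (l + 1 - m) m, csgMove_union (u := star k (l - m)) ?_ ?_ ?_
          (connOn_star _ _) (seg_eq_empty_or_connOn _ _), (csgGrundy_seg _ _ _).symm⟩
        · ext (_ | x)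
          · simp
          · rw [Finset.mem_union, some_mem_star, some_mem_star, some_mem_seg]
            omega
        · rw [Finset.disjoint_left]
          rintro (_ | x)
          · simp
          · rw [some_mem_star, some_mem_seg]
            omega
        · rw [card_star, Set.mem_Icc]
          omega
  · rintro ⟨t, ⟨hts, -, hL, hu, ht⟩, rfl⟩
    have hunion : t ∪ star k l \ t = star k l := Finset.union_sdiff_of_subset hts
    have hdisj : Disjoint t (star k l \ t) := Finset.disjoint_sdiff
    rw [Set.mem_Icc] at hL
    rcases ht with rfl | ht
    · rw [Finset.sdiff_empty, card_star] at hL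
      refine Or.inr (Or.inr (Or.inr ⟨0, by omega, by omega, ?_⟩))
      simpa [seg] using csgGrundy_seg N 0 0
    · generalize star k l \ t = u at *
      by_cases hn : none ∈ t
      · rcases split_star hunion hdisj ht hu hn with
          ⟨i, hi, rfl, c, rfl⟩ | ⟨j, hj, rfl, c, rfl⟩ | ⟨rfl, c, rfl⟩
        · rw [card_seg] at hL
          exact Or.inl ⟨i, hi, by omega, rfl⟩
        · rw [card_seg] at hL
          exact Or.inr (Or.inl ⟨j, hj, by omega, rfl⟩)
        · rw [card_seg] at hL
          rw [csgGrundy_none hN]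
          have h1 : 1 = 1 % (N + 1) := (Nat.mod_eq_of_lt (by omega)).symm
          by_cases hkl : k + l = 0
          · refine Or.inr (Or.inr (Or.inl ?_))
            rwa [hkl]
          · exact Or.inr (Or.inr (Or.inr ⟨1, by omega, by omega, h1⟩))
      · have hnu : none ∈ u := by
          have : none ∈ t ∪ u := hunion ▸ none_mem_star
          exact (Finset.mem_union.1 this).resolve_left hn
        rw [Finset.union_comm] at hunion
        rcases split_star hunion hdisj.symm hu ht hnu with
          ⟨i, hi, rfl, c, rfl⟩ | ⟨j, hj, rfl, c, rfl⟩ | ⟨rfl, c, rfl⟩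
        · rw [card_star] at hL
          exact Or.inr (Or.inr (Or.inr ⟨k - i, by omega, by omega, csgGrundy_seg _ _ _⟩))
        · rw [card_star] at hL
          exact Or.inr (Or.inr (Or.inr ⟨l - j, by omega, by omega, csgGrundy_seg _ _ _⟩))
        · exact Or.inr (Or.inr (Or.inl (csgGrundy_seg _ _ _)))

/-- The position in `leafedLine` of the `j`-th vertex of the `i`-th branch of `S(1, k, l)`. -/
def ofBranch (i j : ℕ) : Option ℤ :=
  if i = 0 then none else if i = 1 then some (-(j : ℤ) - 1) else some ((j : ℤ) + 1)

/-- The position in `leafedLine` of a vertex of `S(1, k, l)`. -/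
def ofStar (k l : ℕ) : Option (Σ i : Fin 3, Fin (![1, k, l] i)) → Option ℤ
  | none => some 0
  | some ⟨i, j⟩ => ofBranch i j

theorem lt_of_lt_branch {k l j : ℕ} {i : Fin 3} (h : j < ![1, k, l] i) :
    (i : ℕ) = 0 ∧ j = 0 ∨ (i : ℕ) = 1 ∧ j < k ∨ (i : ℕ) = 2 ∧ j < l := by
  obtain rfl | rfl | rfl : i = 0 ∨ i = 1 ∨ i = 2 := by omega
  · exact Or.inl ⟨rfl, Nat.lt_one_iff.1 h⟩
  · exact Or.inr (Or.inl ⟨rfl, h⟩)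
  · exact Or.inr (Or.inr ⟨rfl, h⟩)

theorem ofStar_injective (k l : ℕ) : Function.Injective (ofStar k l) := by
  rintro (_ | ⟨i, j, hj⟩) (_ | ⟨i', j', hj'⟩) h
  · rfl
  · simp only [ofStar, ofBranch] at h
    split_ifs at h <;> simp only [Option.some.injEq] at h <;> omega
  · simp only [ofStar, ofBranch] at h
    split_ifs at h <;> simp only [Option.some.injEq] at h <;> omega
  · have hij := lt_of_lt_branch hj
    have hij' := lt_of_lt_branch hj'
    obtain ⟨h1, h2⟩ : (i : ℕ) = i' ∧ j = j' := by
      simp only [ofStar, ofBranch] at h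
      split_ifs at h <;> simp only [Option.some.injEq] at h <;> omega
    obtain rfl := Fin.ext h1
    subst h2
    rfl

theorem adj_ofStar {k l : ℕ} (a b : Option (Σ i : Fin 3, Fin (![1, k, l] i))) :
    leafedLine.Adj (ofStar k l a) (ofStar k l b) ↔ (subdividedStar ![1, k, l]).Adj a b := by
  rcases a with _ | ⟨i, j, hj⟩ <;> rcases b with _ | ⟨i', j', hj'⟩
  · simp [ofStar]
  · have hij' := lt_of_lt_branch hj'
    simp only [ofStar, ofBranch, subdividedStar, SimpleGraph.fromRel_adj]
    split_ifs <;> simp <;> omega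
  · have hij := lt_of_lt_branch hj
    simp only [ofStar, ofBranch, subdividedStar, SimpleGraph.fromRel_adj]
    split_ifs <;> simp <;> omega
  · have hij := lt_of_lt_branch hj
    have hij' := lt_of_lt_branch hj'
    have hadj : (subdividedStar ![1, k, l]).Adj (some ⟨i, j, hj⟩) (some ⟨i', j', hj'⟩) ↔
        (i : ℕ) = i' ∧ (j + 1 = j' ∨ j' + 1 = j) := by
      simp only [subdividedStar, SimpleGraph.fromRel_adj]
      constructor
      · omega
      · intro h
        refine ⟨?_, by omega⟩
        rintro e
        have : j = j' := by
          cases e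
          rfl
        omega
    rw [hadj]
    simp only [ofStar, ofBranch]
    split_ifs <;> simp <;> omega

/-- The embedding of `S(1, k, l)` into `leafedLine`. -/
def starEmbedding (k l : ℕ) : subdividedStar ![1, k, l] ↪g leafedLine where
  toFun := ofStar k l
  inj' := ofStar_injective k l
  map_rel_iff' := adj_ofStar _ _

theorem map_starEmbedding (k l : ℕ) :
    Finset.univ.map (starEmbedding k l).toEmbedding = star k l := by
  refine Finset.eq_of_subset_of_card_le ?_ ?_
  · intro x hx
    obtain ⟨(_ | ⟨i, j, hj⟩), -, rfl⟩ := Finset.mem_map.1 hx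
    · change some 0 ∈ _
      simp
    · have hij := lt_of_lt_branch hj
      change ofBranch i j ∈ _
      simp only [ofBranch]
      split_ifs <;> simp <;> omega
  · simp [Fin.sum_univ_succ]

theorem csgGrundy_subdividedStar (k l : ℕ) (L : Set ℕ) :
    csgGrundy (subdividedStar ![1, k, l]) L Finset.univ = csgGrundy leafedLine L (star k l) := by
  rw [← map_starEmbedding, csgGrundy_map]

end leafedLine

/-- For CSG({1,…,N}), N ≥ 3: if k > N and l ≡ N mod (N+1), then the Grundy
value of S(1,k,l) equals that of S(1, (k mod (N+1)) + N + 1, N). -/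
theorem stmt13 (N k l : ℕ) (hN : 3 ≤ N) (hk : N < k) (hl : l % (N + 1) = N) :
    csgGrundy (subdividedStar ![1, k, l]) (Set.Icc 1 N) Finset.univ =
    csgGrundy (subdividedStar ![1, k % (N + 1) + N + 1, N])
      (Set.Icc 1 N) Finset.univ := by
  rw [leafedLine.csgGrundy_subdividedStar, leafedLine.csgGrundy_subdividedStar]
  exact star_periodic (by omega) (leafedLine.isMex_star (by omega)) hk hl
end

section
/- For the game CSG({1,2,4}), the Grundy value of the subdivided star S(1,1,k) equals (k+3) mod 3 = k mod 3 for every k ≥ 0; i.e. it equals the number of vertices of S(1,1,k) taken mod 3. -/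
open SimpleGraph

section Grundy

variable {V : Type*} {G : SimpleGraph V}

lemma mex_eq_of_forall {A : Set ℕ} {n : ℕ} (hn : n ∉ A) (h : ∀ m < n, m ∈ A) : mex A = n :=
  le_antisymm (Nat.sInf_le hn) (le_csInf ⟨n, hn⟩ fun m hm => by
    by_contra! hlt
    exact hm (h m hlt))

lemma ConnOn.of_induce_compl_singleton {s : Set V} {v : s}
    (h : ((G.induce s).induce {v}ᶜ).Connected) : ConnOn G (s \ {v.1}) :=
  h.map (⟨fun x => ⟨x.1.1, x.1.2, fun hx => x.2 (Subtype.ext hx)⟩, fun hx => hx⟩ :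
    (G.induce s).induce {v}ᶜ →g G.induce (s \ {v.1}))
    fun y => ⟨⟨⟨y.1, y.2.1⟩, fun hy => y.2.2 (congrArg Subtype.val hy)⟩, rfl⟩

lemma ConnOn.singleton (v : V) : ConnOn G {v} := by
  have : Nonempty ({v} : Set V) := ⟨v, rfl⟩
  exact ⟨Preconnected.of_subsingleton⟩

lemma ConnOn.exists_adj {s : Set V} (h : ConnOn G s) (hs : s.Nontrivial) {v : V} (hv : v ∈ s) :
    ∃ w ∈ s, G.Adj v w := by
  have : Nontrivial s := hs.coe_sort
  obtain ⟨w, hw⟩ := h.preconnected.exists_adj_of_nontrivial ⟨v, hv⟩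
  exact ⟨w.1, w.2, hw⟩

/-- Removing a vertex with at most one neighbour preserves connectedness. -/
lemma ConnOn.sdiff_singleton {s : Set V} (h : ConnOn G s) (hs : s.Nontrivial) {v w : V}
    (hv : v ∈ s) (hw : ∀ u ∈ s, G.Adj v u → u = w) : ConnOn G (s \ {v}) := by
  classical
  obtain ⟨u, hu, hvu⟩ := h.exists_adj hs hv
  have hunique : ∃! x : s, (G.induce s).Adj ⟨v, hv⟩ x :=
    ⟨⟨u, hu⟩, hvu, fun y hy => Subtype.ext ((hw y y.2 hy).trans (hw u hu hvu).symm)⟩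
  have : Fintype ((G.induce s).neighborSet ⟨v, hv⟩) :=
    Set.Finite.fintype (Set.Subsingleton.finite fun x hx y hy => hunique.unique hx hy)
  exact ConnOn.of_induce_compl_singleton
    (h.induce_compl_singleton_of_degree_eq_one (degree_eq_one_iff_existsUnique_adj.2 hunique))

lemma ConnOn.exists_sdiff_singleton [DecidableEq V] {s : Finset V} (h : ConnOn G (s : Set V))
    (hs : s.Nontrivial) : ∃ v ∈ s, ConnOn G (↑(s \ {v}) : Set V) := by
  have : Nontrivial (s : Set V) := Set.Nontrivial.coe_sort hs
  obtain ⟨v, hv⟩ := SimpleGraph.Connected.exists_connected_induce_compl_singleton_of_finite_nontrivial h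
  refine ⟨v.1, v.2, ?_⟩
  rw [Finset.coe_sdiff, Finset.coe_singleton]
  exact ConnOn.of_induce_compl_singleton hv

variable [DecidableEq V] {L : Set ℕ} {s t : Finset V}

lemma CsgMove.card_add_card_sdiff (h : CsgMove G L s t) : t.card + (s \ t).card = s.card :=
  (add_comm _ _).trans (Finset.card_sdiff_add_card_eq_card h.1)

lemma CsgMove.sdiff {u : Finset V} (hus : u ⊆ s) (hu : u.Nonempty) (hL : u.card ∈ L)
    (hconn : ConnOn G (u : Set V)) (h : s \ u = ∅ ∨ ConnOn G (↑(s \ u) : Set V)) :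
    CsgMove G L s (s \ u) := by
  rw [CsgMove, Finset.sdiff_sdiff_eq_self hus]
  exact ⟨Finset.sdiff_subset, hu, hL, hconn, h⟩

lemma csgGrundy_eq_of_forall {n : ℕ} (hn : ∀ t, CsgMove G L s t → csgGrundy G L t ≠ n)
    (h : ∀ m < n, ∃ t, CsgMove G L s t ∧ csgGrundy G L t = m) : csgGrundy G L s = n := by
  rw [csgGrundy]
  apply mex_eq_of_forall
  · rintro ⟨t, ht⟩
    exact hn t.1 t.2 ht
  · intro m hm
    obtain ⟨t, ht, htm⟩ := h m hm
    exact ⟨⟨t, ht⟩, htm⟩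

lemma exists_csgMove_card_add_one (hL : 1 ∈ L) (hne : s.Nonempty) (h : ConnOn G (s : Set V)) :
    ∃ t, CsgMove G L s t ∧ t.card + 1 = s.card := by
  suffices ∃ v ∈ s, s \ {v} = ∅ ∨ ConnOn G (↑(s \ {v}) : Set V) by
    obtain ⟨v, hv, hvs⟩ := this
    have hmove : CsgMove G L s (s \ {v}) :=
      CsgMove.sdiff (by simpa using hv) (Finset.singleton_nonempty v) (by simpa using hL)
        (by simpa using ConnOn.singleton v) hvs
    refine ⟨_, hmove, ?_⟩
    simpa [Finset.sdiff_sdiff_eq_self, hv] using hmove.card_add_card_sdiff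
  obtain ⟨v, rfl⟩ | hs := hne.exists_eq_singleton_or_nontrivial
  · exact ⟨v, by simp⟩
  · obtain ⟨v, hv, hvs⟩ := h.exists_sdiff_singleton hs
    exact ⟨v, hv, Or.inr hvs⟩

/-- If every connected position with at least five vertices admits a move removing two vertices,
the Grundy values of CSG({1,2,4}) on connected positions are the orders modulo three. -/
lemma csgGrundy_one_two_four
    (hG : ∀ s : Finset V, ConnOn G (s : Set V) → 5 ≤ s.card →
      ∃ t, CsgMove G {1, 2, 4} s t ∧ t.card + 2 = s.card)
    (s : Finset V) (hs : s = ∅ ∨ ConnOn G (s : Set V)) :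
    csgGrundy G {1, 2, 4} s = s.card % 3 := by
  induction hc : s.card using Nat.strong_induction_on generalizing s with
  | _ n ih =>
  subst hc
  have ih' : ∀ t, CsgMove G {1, 2, 4} s t → csgGrundy G {1, 2, 4} t = t.card % 3 := by
    intro t ht
    refine ih t.card ?_ t ht.2.2.2.2 rfl
    have := ht.card_add_card_sdiff
    have := ht.2.1.card_pos
    omega
  apply csgGrundy_eq_of_forall
  · intro t ht
    rw [ih' t ht]
    have hcard := ht.card_add_card_sdiff
    have hL := ht.2.2.1
    simp only [Set.mem_insert_iff, Set.mem_singleton_iff] at hL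
    omega
  · intro m hm
    have hpos : s.Nonempty := Finset.card_pos.1 (by omega)
    have hconn : ConnOn G (s : Set V) := hs.resolve_left hpos.ne_empty
    suffices ∃ t, CsgMove G {1, 2, 4} s t ∧ t.card % 3 = m by
      obtain ⟨t, ht, htm⟩ := this
      exact ⟨t, ht, (ih' t ht).trans htm⟩
    by_cases hm1 : s.card % 3 = m + 1
    · obtain ⟨t, ht, htc⟩ := exists_csgMove_card_add_one (L := {1, 2, 4}) (by simp) hpos hconn
      exact ⟨t, ht, by omega⟩
    by_cases hs2 : s.card = 2
    · refine ⟨∅, ⟨by simp, by simpa using hpos, by simp [hs2], by simpa using hconn,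
        Or.inl rfl⟩, ?_⟩
      rw [Finset.card_empty]
      omega
    · obtain ⟨t, ht, htc⟩ := hG s hconn (by omega)
      exact ⟨t, ht, by omega⟩

end Grundy

section SubdividedStar

variable {n : ℕ} {l : Fin n → ℕ}

lemma subdividedStar_adj_none_some {i : Fin n} {j : Fin (l i)} :
    (subdividedStar l).Adj none (some ⟨i, j⟩) ↔ (j : ℕ) = 0 := by
  simp [subdividedStar]

lemma subdividedStar_adj_some_some {i i' : Fin n} {j : Fin (l i)} {j' : Fin (l i')} :
    (subdividedStar l).Adj (some ⟨i, j⟩) (some ⟨i', j'⟩) ↔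
      i = i' ∧ ((j : ℕ) + 1 = j' ∨ (j' : ℕ) + 1 = j) := by
  simp only [subdividedStar, fromRel_adj]
  constructor
  · rintro ⟨-, h | h⟩
    · exact ⟨Fin.ext h.1, Or.inl h.2⟩
    · exact ⟨Fin.ext h.1.symm, Or.inr h.2⟩
  · rintro ⟨rfl, h⟩
    refine ⟨fun heq => ?_, by simpa using h⟩
    obtain rfl : j = j' := by simpa using heq
    omega

lemma subdividedStar_connected (l : Fin n → ℕ) : (subdividedStar l).Connected := by
  refine (connected_iff_exists_forall_reachable _).2 ⟨none, ?_⟩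
  suffices ∀ (i : Fin n) (j : ℕ) (hj : j < l i),
      (subdividedStar l).Reachable none (some ⟨i, ⟨j, hj⟩⟩) by
    rintro (_ | ⟨i, j⟩)
    · exact Reachable.refl _
    · exact this i j j.2
  intro i j
  induction j with
  | zero => exact fun hj => (subdividedStar_adj_none_some.2 rfl).reachable
  | succ j ih =>
    exact fun hj => (ih (by omega)).trans
      (subdividedStar_adj_some_some.2 ⟨rfl, Or.inl rfl⟩).reachable

/-- The last two vertices of a branch of a connected vertex set can be removed together. -/
lemma exists_csgMove_of_mem_branch {L : Set ℕ} (hL : 2 ∈ L)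
    {s : Finset (Option (Σ i : Fin n, Fin (l i)))}
    (hs : ConnOn (subdividedStar l) (s : Set _)) (hcard : 3 ≤ s.card) {i : Fin n} {j : Fin (l i)}
    (hj : (j : ℕ) ≠ 0) (hmem : some ⟨i, j⟩ ∈ s) :
    ∃ t, CsgMove (subdividedStar l) L s t ∧ t.card + 2 = s.card := by
  classical
  obtain ⟨m, hm, hmax⟩ := (Finset.univ.filter fun j : Fin (l i) => some ⟨i, j⟩ ∈ s).exists_max_image
    id ⟨j, by simpa using hmem⟩
  simp only [Finset.mem_filter, Finset.mem_univ, true_and, id] at hm hmax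
  have hjm : (j : ℕ) ≤ m := hmax j hmem
  have hms : (m : ℕ) - 1 < l i := by omega
  set p : Fin (l i) := ⟨(m : ℕ) - 1, hms⟩ with hp
  have hpm : (p : ℕ) + 1 = m := by simp only [hp]; omega
  have hnbr : ∀ u ∈ s, (subdividedStar l).Adj (some ⟨i, m⟩) u → u = some ⟨i, p⟩ := by
    rintro (_ | ⟨i', j'⟩) hu hadj
    · have := subdividedStar_adj_none_some.1 hadj.symm
      omega
    · obtain ⟨rfl, h⟩ := subdividedStar_adj_some_some.1 hadj
      have : (j' : ℕ) ≤ m := hmax j' hu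
      obtain rfl : j' = p := Fin.ext (by omega)
      rfl
  have hnt : (s : Set (Option (Σ i : Fin n, Fin (l i)))).Nontrivial :=
    Finset.one_lt_card_iff_nontrivial.1 (by omega)
  have hps : some ⟨i, p⟩ ∈ s := by
    obtain ⟨w, hw, hadj⟩ := hs.exists_adj hnt hm
    rwa [← hnbr w hw hadj]
  have hne : (some ⟨i, m⟩ : Option (Σ i : Fin n, Fin (l i))) ≠ some ⟨i, p⟩ := by
    intro h
    have : m = p := by simpa using h
    omega
  have hadj : (subdividedStar l).Adj (some ⟨i, m⟩) (some ⟨i, p⟩) :=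
    subdividedStar_adj_some_some.2 ⟨rfl, Or.inr hpm⟩
  have h₁ := hs.sdiff_singleton hnt hm hnbr
  have hcard₁ : (s \ {some ⟨i, m⟩}).card + 1 = s.card :=
    Finset.card_sdiff_add_card_eq_card (by simpa using hm)
  have hnt₁ : ((s : Set (Option (Σ i : Fin n, Fin (l i)))) \ {some ⟨i, m⟩}).Nontrivial := by
    have : (s \ {some ⟨i, m⟩}).Nontrivial := Finset.one_lt_card_iff_nontrivial.1 (by omega)
    simpa [Finset.Nontrivial] using this
  have h₂ : ConnOn (subdividedStar l)
      (((s : Set (Option (Σ i : Fin n, Fin (l i)))) \ {some ⟨i, m⟩}) \ {some ⟨i, p⟩}) := by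
    refine h₁.sdiff_singleton (w := if hp0 : (p : ℕ) = 0 then none else
      some ⟨i, ⟨(p : ℕ) - 1, by omega⟩⟩) hnt₁ ⟨hps, hne.symm⟩ ?_
    rintro (_ | ⟨i', j'⟩) hu hadj
    · have := subdividedStar_adj_none_some.1 hadj.symm
      simp [this]
    · obtain ⟨rfl, h⟩ := subdividedStar_adj_some_some.1 hadj
      have hj' : j' ≠ m := by
        rintro rfl
        exact hu.2 rfl
      have hj'' : (j' : ℕ) + 1 = p := by
        have := Fin.val_ne_of_ne hj'
        omega
      rw [dif_neg (by omega)]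
      congr
      exact Fin.ext (by simp [← hj''])
  rw [Set.sdiff_sdiff, Set.singleton_union] at h₂
  have hpair : ({some ⟨i, m⟩, some ⟨i, p⟩} : Finset (Option (Σ i : Fin n, Fin (l i)))).card = 2 :=
    Finset.card_pair hne
  have hsub : ({some ⟨i, m⟩, some ⟨i, p⟩} : Finset (Option (Σ i : Fin n, Fin (l i)))) ⊆ s := by
    simp [Finset.insert_subset_iff, hm, hps]
  have hmove : CsgMove (subdividedStar l) L s (s \ {some ⟨i, m⟩, some ⟨i, p⟩}) := by
    refine CsgMove.sdiff hsub (by simp) (by rwa [hpair]) ?_ (Or.inr ?_)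
    · rw [Finset.coe_pair]
      exact induce_pair_connected_of_adj hadj
    · rw [Finset.coe_sdiff, Finset.coe_pair]
      exact h₂
  refine ⟨_, hmove, ?_⟩
  rw [← hpair]
  exact Finset.card_sdiff_add_card_eq_card hsub

/-- More than `n + 1` vertices of a subdivided star with `n` branches cannot all lie at distance at
most one from the centre. -/
lemma exists_mem_branch_ne_zero {s : Finset (Option (Σ i : Fin n, Fin (l i)))}
    (hcard : n + 1 < s.card) : ∃ i, ∃ j : Fin (l i), (j : ℕ) ≠ 0 ∧ some ⟨i, j⟩ ∈ s := by
  by_contra! h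
  have hinj : Set.InjOn (Option.map Sigma.fst) (s : Set (Option (Σ i : Fin n, Fin (l i)))) := by
    rintro (_ | ⟨i, j⟩) hx (_ | ⟨i', j'⟩) hy hxy
    · rfl
    · simp at hxy
    · simp at hxy
    · obtain rfl : i = i' := by simpa using hxy
      have hj : (j : ℕ) = 0 := by_contra fun hj => h i j hj hx
      have hj' : (j' : ℕ) = 0 := by_contra fun hj => h i j' hj hy
      obtain rfl : j = j' := Fin.ext (hj.trans hj'.symm)
      rfl
  have := Finset.card_le_card_of_injOn (t := Finset.univ) _ (by simp) hinj
  simp only [Finset.card_univ, Fintype.card_option, Fintype.card_fin] at this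
  omega

end SubdividedStar

/-- For CSG({1,2,4}), the Grundy value of S(1,1,k) is its number of vertices
k+3 taken mod 3, i.e. k mod 3. -/
theorem stmt17 (k : ℕ) :
    csgGrundy (subdividedStar ![1, 1, k]) ({1, 2, 4} : Set ℕ) Finset.univ =
      (k + 3) % 3 := by
  have hcard : (Finset.univ : Finset (Option (Σ i : Fin 3, Fin (![1, 1, k] i)))).card = k + 3 := by
    simp [Fin.sum_univ_three]
    omega
  rw [← hcard]
  refine csgGrundy_one_two_four (fun s hs h5 => ?_) _ (Or.inr ?_)
  · obtain ⟨i, j, hj, hmem⟩ := exists_mem_branch_ne_zero (s := s) (by omega)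
    exact exists_csgMove_of_mem_branch (by simp) hs (by omega) hj hmem
  · rw [Finset.coe_univ]
    exact (induceUnivIso _).connected_iff.2 (subdividedStar_connected _)
end
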